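/- arXiv:1201.4572 — 2 statements merged into one kernel-verified Lean document; each statement's English description precedes it below -/
import Mathlib

section
/- Let 1 ≤ m ≤ n and let λ = (λ_1 ≥ … ≥ λ_n ≥ 0) be a partition of n(n−1) with at least n−1 nonzero parts such that λ_1 = λ_2 = … = λ_m = 2n−m−1. Let μ be the partition of n(n+1) with n+1 parts given by μ_1 = μ_2 = … = μ_{m+1} = 2n−m and, if m < n, μ_j = λ_{j−1} for j = m+2, …, n+1. Then ⟨a_{δ_{n+1}}^2, s_μ⟩ = (−1)^m (2m+1) ⟨a_{δ_n}^2, s_λ⟩. -/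
open MvPolynomial Finset

/-- The Vandermonde determinant `a_{δ_n} = ∏_{1 ≤ i < j ≤ n} (x_i - x_j)`
as a multivariate polynomial over `ℤ` in variables indexed by `Fin n`. -/
noncomputable def vandermondePoly (n : ℕ) : MvPolynomial (Fin n) ℤ :=
  ∏ p ∈ Finset.univ.filter (fun p : Fin n × Fin n => p.1 < p.2), (X p.1 - X p.2)

/-- `⟨a_{δ_n}^{2k}, s_λ⟩`: the coefficient of the Schur function `s_λ` in the expansion
of `a_{δ_n}^{2k}`, i.e. the coefficient of the monomial
`x^{λ+δ_n} = x_1^{λ_1+n-1} x_2^{λ_2+n-2} ⋯ x_n^{λ_n}` in `a_{δ_n}^{2k+1}`.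
Here `lam i` is the part `λ_{i+1}` (0-indexed) and `δ_n` has `i`-th entry `n - 1 - i`. -/
noncomputable def schurCoeff (n k : ℕ) (lam : Fin n → ℕ) : ℤ :=
  MvPolynomial.coeff
    (Finsupp.equivFunOnFinite.symm fun i : Fin n => lam i + (n - 1 - (i : ℕ)))
    (vandermondePoly n ^ (2 * k + 1))


section Dyson

variable {σ : Type*}

theorem coeff_prod_sub_pow_mul (e : σ →₀ ℕ) (k : σ) (hk : e k = 0) (t : Finset σ) (a : σ → ℕ)
    (Q : MvPolynomial σ ℤ) :
    coeff e ((∏ j ∈ t, (X j - X k) ^ a j) * Q) = coeff e ((∏ j ∈ t, X j ^ a j) * Q) := by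
  classical
  have step (j : σ) (n : ℕ) (Q : MvPolynomial σ ℤ) :
      coeff e ((X j - X k) ^ n * Q) = coeff e (X j ^ n * Q) := by
    induction n generalizing Q with
    | zero => simp
    | succ n ih =>
      rw [pow_succ', mul_assoc, sub_mul, coeff_sub, coeff_X_mul' e k,
        if_neg (by simpa using hk), sub_zero, mul_left_comm, ih, pow_succ, mul_assoc]
  induction t using Finset.induction_on generalizing Q with
  | empty => simp
  | insert j t hj ih =>
    rw [prod_insert hj, prod_insert hj, mul_assoc, step, mul_left_comm, ih]
    congr 1
    ring

variable [DecidableEq σ]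

/-- The product `∏_{i ≠ j} (1 - x_i / x_j) ^ a_j` of Dyson's conjecture, over indices in `s` and
with denominators cleared. -/
noncomputable def dysonPoly (s : Finset σ) (a : σ → ℕ) : MvPolynomial σ ℤ :=
  ∏ j ∈ s, ∏ i ∈ s.erase j, (X j - X i) ^ a j

/-- The exponent of `dysonPoly s a` corresponding to the constant term. -/
noncomputable def dysonExponent (s : Finset σ) (a : σ → ℕ) : σ →₀ ℕ :=
  ∑ j ∈ s, Finsupp.single j ((#s - 1) * a j)

theorem dysonPoly_eq_mul_update {s : Finset σ} {a : σ → ℕ} {k : σ} (hk : k ∈ s) (ha : a k ≠ 0) :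
    dysonPoly s a =
      (∏ i ∈ s.erase k, (X k - X i)) * dysonPoly s (Function.update a k (a k - 1)) := by
  unfold dysonPoly
  rw [← mul_prod_erase s (fun j => ∏ i ∈ s.erase j, (X j - X i : MvPolynomial σ ℤ) ^ a j) hk,
    ← mul_prod_erase s (fun j => ∏ i ∈ s.erase j,
      (X j - X i : MvPolynomial σ ℤ) ^ Function.update a k (a k - 1) j) hk,
    ← mul_assoc]
  refine congrArg₂ (· * ·) ?_ (prod_congr rfl fun j hj => prod_congr rfl fun i _ => ?_)
  · rw [← prod_mul_distrib]
    refine prod_congr rfl fun i _ => ?_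
    rw [Function.update_self, mul_pow_sub_one ha]
  · rw [Function.update_of_ne (ne_of_mem_erase hj)]

theorem dysonExponent_eq_add_update {s : Finset σ} {a : σ → ℕ} {k : σ} (hk : k ∈ s)
    (ha : a k ≠ 0) :
    dysonExponent s a =
      Finsupp.single k (#s - 1) + dysonExponent s (Function.update a k (a k - 1)) := by
  unfold dysonExponent
  rw [← add_sum_erase s _ hk, ← add_sum_erase s _ hk, ← add_assoc, ← Finsupp.single_add]
  congr 1
  · rw [Function.update_self, ← mul_one_add, Nat.add_sub_of_le (Nat.one_le_iff_ne_zero.2 ha)]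
  · refine sum_congr rfl fun j hj => ?_
    rw [Function.update_of_ne (ne_of_mem_erase hj)]

/-- Good's recursion, a consequence of Lagrange interpolation. -/
theorem dysonPoly_eq_sum {s : Finset σ} (hs : s.Nonempty) {a : σ → ℕ} (ha : ∀ k ∈ s, a k ≠ 0) :
    dysonPoly s a =
      ∑ k ∈ s, X k ^ (#s - 1) * dysonPoly s (Function.update a k (a k - 1)) := by
  let K := FractionRing (MvPolynomial σ ℤ)
  let v : σ → K := fun i => algebraMap (MvPolynomial σ ℤ) K (X i)
  have hinj : Function.Injective (algebraMap (MvPolynomial σ ℤ) K) :=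
    IsFractionRing.injective _ _
  have hv : Set.InjOn v s := (hinj.comp (X_injective (σ := σ) (R := ℤ))).injOn
  have key := Lagrange.coeff_eq_sum hv (P := (Polynomial.X : Polynomial K) ^ (#s - 1)) (by
    rw [Polynomial.degree_X_pow]
    exact_mod_cast Nat.sub_lt hs.card_pos one_pos)
  simp only [Polynomial.coeff_X_pow, if_true, Polynomial.eval_pow, Polynomial.eval_X] at key
  apply hinj
  rw [← one_mul (algebraMap _ K (dysonPoly s a)), key, sum_mul, map_sum]
  refine sum_congr rfl fun k hk => ?_
  have hne : ∏ j ∈ s.erase k, (v k - v j) ≠ 0 :=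
    prod_ne_zero_iff.2 fun j hj =>
      sub_ne_zero.2 fun h => ne_of_mem_erase hj (hv (mem_of_mem_erase hj) hk h.symm)
  rw [dysonPoly_eq_mul_update hk (ha k hk), map_mul, map_mul, map_pow, map_prod]
  simp only [map_sub]
  change _ / _ * ((∏ j ∈ s.erase k, (v k - v j)) * _) = v k ^ _ * _
  rw [← mul_assoc, div_mul_cancel₀ _ hne]

theorem coeff_dysonPoly_insert {t : Finset σ} {k : σ} (hk : k ∉ t) {a : σ → ℕ} (ha : a k = 0) :
    coeff (dysonExponent (insert k t) a) (dysonPoly (insert k t) a) =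
      coeff (dysonExponent t a) (dysonPoly t a) := by
  have hpoly : dysonPoly (insert k t) a = (∏ j ∈ t, (X j - X k) ^ a j) * dysonPoly t a := by
    unfold dysonPoly
    rw [prod_insert hk, ← prod_mul_distrib]
    simp only [ha, pow_zero, prod_const_one, one_mul]
    refine prod_congr rfl fun j hj => ?_
    have hjk : j ≠ k := fun h => hk (h ▸ hj)
    rw [erase_insert_of_ne hjk.symm, prod_insert fun h => hk (mem_of_mem_erase h)]
  have hexp : dysonExponent (insert k t) a =
      ∑ j ∈ t, Finsupp.single j (a j) + dysonExponent t a := by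
    unfold dysonExponent
    rw [sum_insert hk, ← sum_add_distrib, ha, mul_zero, Finsupp.single_zero, zero_add]
    refine sum_congr rfl fun j hj => ?_
    rw [← Finsupp.single_add, card_insert_of_notMem hk]
    congr 1
    obtain ⟨b, hb⟩ := Nat.exists_eq_succ_of_ne_zero (card_pos.2 ⟨j, hj⟩).ne'
    simp [hb]
    ring
  have hzero : dysonExponent (insert k t) a k = 0 := by
    simp only [dysonExponent, Finsupp.finsetSum_apply]
    refine sum_eq_zero fun j _ => ?_
    rcases eq_or_ne j k with rfl | h
    · simp [ha]
    · simp [h]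
  have hmon : (∏ j ∈ t, X j ^ a j : MvPolynomial σ ℤ) =
      monomial (∑ j ∈ t, Finsupp.single j (a j)) 1 := by
    simp only [X_pow_eq_monomial, monomial_sum_one]
  rw [hpoly, coeff_prod_sub_pow_mul _ k hzero, hexp, hmon, coeff_monomial_mul, one_mul]

/-- Dyson's constant term identity. -/
theorem coeff_dysonPoly (s : Finset σ) (a : σ → ℕ) :
    coeff (dysonExponent s a) (dysonPoly s a) * ∏ j ∈ s, ((a j).factorial : ℤ) =
      ((∑ j ∈ s, a j).factorial : ℤ) := by
  induction hN : #s + ∑ j ∈ s, a j using Nat.strong_induction_on generalizing s a with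
  | _ N ih =>
  subst hN
  rcases s.eq_empty_or_nonempty with rfl | hs
  · simp [dysonPoly, dysonExponent]
  by_cases ha : ∀ k ∈ s, a k ≠ 0
  · have hterm : ∀ k ∈ s,
        coeff (dysonExponent s a) (X k ^ (#s - 1) * dysonPoly s (Function.update a k (a k - 1))) *
          ∏ j ∈ s, ((a j).factorial : ℤ) = a k * ((∑ j ∈ s, a j) - 1).factorial := by
      intro k hk
      have hsum : ∑ j ∈ s, Function.update a k (a k - 1) j = (∑ j ∈ s, a j) - 1 := by
        rw [sum_update_of_mem hk, ← add_sum_erase s a hk, sdiff_singleton_eq_erase]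
        have := ha k hk
        omega
      have hpos : a k ≤ ∑ j ∈ s, a j := single_le_sum (fun _ _ => Nat.zero_le _) hk
      have hfac : ∏ j ∈ s, ((a j).factorial : ℤ) =
          a k * ∏ j ∈ s, ((Function.update a k (a k - 1) j).factorial : ℤ) := by
        rw [← mul_prod_erase s _ hk, ← mul_prod_erase s _ hk, ← mul_assoc, Function.update_self,
          ← Nat.mul_factorial_pred (ha k hk), Nat.cast_mul]
        congr 1
        refine prod_congr rfl fun j hj => ?_
        rw [Function.update_of_ne (ne_of_mem_erase hj)]
      rw [dysonExponent_eq_add_update hk (ha k hk), X_pow_eq_monomial, coeff_monomial_mul,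
        one_mul, hfac, mul_left_comm, ih _ _ s _ rfl, hsum]
      rw [hsum]
      have := ha k hk
      omega
    rw [dysonPoly_eq_sum hs ha, coeff_sum, sum_mul, sum_congr rfl hterm, ← sum_mul]
    have hne : ∑ j ∈ s, a j ≠ 0 := by
      obtain ⟨k, hk⟩ := hs
      have : a k ≤ ∑ j ∈ s, a j := single_le_sum (fun _ _ => Nat.zero_le _) hk
      have := ha k hk
      omega
    rw [← Nat.mul_factorial_pred hne]
    push_cast
    rfl
  · push Not at ha
    obtain ⟨k, hk, hak⟩ := ha
    obtain ⟨t, hkt, rfl⟩ : ∃ t, k ∉ t ∧ insert k t = s :=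
      ⟨s.erase k, notMem_erase k s, insert_erase hk⟩
    rw [coeff_dysonPoly_insert hkt hak, prod_insert hkt, sum_insert hkt, hak]
    simp only [Nat.factorial_zero, Nat.cast_one, one_mul, zero_add]
    refine ih _ ?_ t a rfl
    rw [card_insert_of_notMem hkt, sum_insert hkt]
    omega

end Dyson
section Vandermonde

variable {n : ℕ}

theorem vandermondePoly_eq_prod_prod (n : ℕ) :
    vandermondePoly n = ∏ i : Fin n, ∏ j ∈ Ioi i, (X i - X j) := by
  rw [vandermondePoly, prod_sigma']
  refine prod_bij' (fun p _ => ⟨p.1, p.2⟩) (fun p _ => (p.1, p.2)) ?_ ?_ ?_ ?_ ?_ <;> simp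

theorem sum_card_Ioi (n : ℕ) : ∑ i : Fin n, #(Ioi i) = n.choose 2 := by
  simp only [Fin.card_Ioi]
  rw [Fin.sum_univ_eq_sum_range (fun i => n - 1 - i) n, sum_range_reflect (fun i => i) n,
    sum_range_id, Nat.choose_two_right]

theorem totalDegree_vandermondePoly_le (n : ℕ) :
    (vandermondePoly n).totalDegree ≤ n.choose 2 := by
  rw [vandermondePoly_eq_prod_prod, ← sum_card_Ioi]
  refine (totalDegree_finsetProd _ _).trans (sum_le_sum fun i _ => ?_)
  refine (totalDegree_finsetProd _ _).trans ?_
  rw [card_eq_sum_ones]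
  refine sum_le_sum fun j _ => (totalDegree_sub _ _).trans ?_
  simp

/-- The Vandermonde determinant in the indeterminates. -/
noncomputable def vandermondeDet (n : ℕ) : MvPolynomial (Fin n) ℤ :=
  (Matrix.vandermonde (X : Fin n → MvPolynomial (Fin n) ℤ)).det

theorem vandermondePoly_eq_det (n : ℕ) :
    vandermondePoly n = (-1) ^ n.choose 2 * vandermondeDet n := by
  rw [vandermondePoly_eq_prod_prod, vandermondeDet, Matrix.det_vandermonde, ← sum_card_Ioi,
    ← prod_pow_eq_pow_sum, ← prod_mul_distrib]
  refine prod_congr rfl fun i _ => ?_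
  rw [← prod_const, ← prod_mul_distrib]
  exact prod_congr rfl fun j _ => by ring

theorem rename_vandermondeDet (τ : Equiv.Perm (Fin n)) :
    rename τ (vandermondeDet n) = (Equiv.Perm.sign τ : ℤ) • vandermondeDet n := by
  rw [vandermondeDet, AlgHom.map_det, zsmul_eq_mul, ← Matrix.det_permute]
  congr 1
  ext i j : 2
  simp [Matrix.vandermonde_apply]

theorem vandermondeDet_eq_sum (n : ℕ) :
    vandermondeDet n = ∑ τ : Equiv.Perm (Fin n), (Equiv.Perm.sign τ : ℤ) •
      monomial (Finsupp.mapDomain τ (Finsupp.equivFunOnFinite.symm fun i : Fin n => (i : ℕ))) 1 := by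
  rw [vandermondeDet, Matrix.det_apply]
  refine sum_congr rfl fun τ _ => ?_
  have : ∏ i, Matrix.vandermonde (X : Fin n → MvPolynomial (Fin n) ℤ) (τ i) i =
      monomial (Finsupp.mapDomain τ (Finsupp.equivFunOnFinite.symm fun i : Fin n => (i : ℕ))) 1 := by
    rw [← rename_monomial, monomial_eq, Finsupp.prod_fintype _ _ (by simp)]
    simp [Matrix.vandermonde_apply]
  rw [this]
  rfl

theorem coeff_mapDomain_vandermondeDet_pow_three (τ : Equiv.Perm (Fin n)) (d : Fin n →₀ ℕ) :
    coeff (Finsupp.mapDomain τ d) (vandermondeDet n ^ 3) =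
      (Equiv.Perm.sign τ : ℤ) * coeff d (vandermondeDet n ^ 3) := by
  have h := coeff_rename_mapDomain τ τ.injective (vandermondeDet n ^ 3) d
  rw [map_pow, rename_vandermondeDet] at h
  rw [← h]
  rcases Int.units_eq_one_or (Equiv.Perm.sign τ) with hs | hs <;> simp [hs, Odd.neg_pow (by decide : Odd 3)]

theorem dysonPoly_univ_two (n : ℕ) :
    dysonPoly (univ : Finset (Fin n)) (fun _ => 2) = vandermondeDet n ^ 4 := by
  have hsplit (f : Fin n → Fin n → MvPolynomial (Fin n) ℤ) :
      ∏ i, ∏ j ∈ univ.erase i, f i j = ∏ i, ∏ j ∈ Ioi i, (f i j * f j i) := by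
    have (i : Fin n) : univ.erase i = Ioi i ∪ Iio i := by
      ext j
      simp [lt_or_lt_iff_ne, eq_comm]
    have hd (i : Fin n) : Disjoint (Ioi i) (Iio i) := by
      rw [disjoint_left]
      intro j
      simpa using le_of_lt
    simp only [this, prod_union (hd _), prod_mul_distrib]
    congr 1
    exact prod_comm' (by simp)
  rw [dysonPoly, hsplit, vandermondeDet, Matrix.det_vandermonde, ← prod_pow]
  refine prod_congr rfl fun i _ => ?_
  rw [← prod_pow]
  exact prod_congr rfl fun j _ => by ring

theorem factorial_mul_coeff_vandermondeDet (n : ℕ) (e : Fin n →₀ ℕ)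
    (he : ∀ i, e i + i = 2 * (n - 1)) :
    (n.factorial : ℤ) * coeff e (vandermondeDet n ^ 3) =
      coeff (dysonExponent univ fun _ => 2) (vandermondeDet n ^ 4) := by
  have hE (τ : Equiv.Perm (Fin n)) : dysonExponent univ (fun _ => 2) = Finsupp.mapDomain τ e +
      Finsupp.mapDomain τ (Finsupp.equivFunOnFinite.symm fun i : Fin n => (i : ℕ)) := by
    rw [← Finsupp.mapDomain_add]
    ext j
    obtain ⟨i, rfl⟩ := τ.surjective j
    rw [Finsupp.mapDomain_apply τ.injective]
    simp [dysonExponent, Finsupp.finsetSum_apply, Finsupp.single_apply, he, mul_comm]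
  have hterm (τ : Equiv.Perm (Fin n)) :
      coeff (dysonExponent univ fun _ => 2) (vandermondeDet n ^ 3 * ((Equiv.Perm.sign τ : ℤ) •
        monomial (Finsupp.mapDomain τ (Finsupp.equivFunOnFinite.symm fun i : Fin n => (i : ℕ))) 1)) =
      coeff e (vandermondeDet n ^ 3) := by
    rw [hE τ, mul_smul_comm, coeff_smul, coeff_mul_monomial, mul_one,
      coeff_mapDomain_vandermondeDet_pow_three, smul_eq_mul, ← mul_assoc]
    rcases Int.units_eq_one_or (Equiv.Perm.sign τ) with hs | hs <;> simp [hs]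
  rw [pow_succ _ 3]
  nth_rw 3 [vandermondeDet_eq_sum]
  rw [mul_sum, coeff_sum, sum_congr rfl fun τ _ => hterm τ]
  simp [Fintype.card_perm]

theorem coeff_vandermondePoly_pow_three (n : ℕ) (e : Fin n →₀ ℕ)
    (he : ∀ i, e i + i = 2 * (n - 1)) :
    coeff e (vandermondePoly n ^ 3) * (n.factorial * 2 ^ n) =
      (-1) ^ n.choose 2 * ((2 * n).factorial : ℤ) := by
  have hD := coeff_dysonPoly (univ : Finset (Fin n)) fun _ => 2
  rw [dysonPoly_univ_two, ← factorial_mul_coeff_vandermondeDet n e he] at hD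
  have hpow : vandermondePoly n ^ 3 = C ((-1) ^ n.choose 2) * vandermondeDet n ^ 3 := by
    rw [vandermondePoly_eq_det, mul_pow, ← pow_mul, mul_comm (n.choose 2), pow_mul]
    simp
    left
    norm_num
  simp only [prod_const, sum_const, card_univ, Fintype.card_fin, smul_eq_mul] at hD
  rw [hpow, coeff_C_mul, mul_comm 2 n, ← hD]
  simp
  ring

end Vandermonde
section Split

theorem coeff_mul_prod_X_sub_C {σ ι R : Type*} [CommRing R] [Nontrivial R] (T : Finset ι)
    (v : ι → σ) (c : ι → R) (f : MvPolynomial σ R) (e : σ →₀ ℕ)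
    (he : f.totalDegree + #T ≤ e.degree) :
    coeff e (f * ∏ l ∈ T, (X (v l) - C (c l))) = coeff e (f * ∏ l ∈ T, X (v l)) := by
  classical
  induction T using Finset.induction_on generalizing f with
  | empty => simp
  | insert l T hl ih =>
    rw [card_insert_of_notMem hl] at he
    have hX : (f * X (v l)).totalDegree ≤ f.totalDegree + 1 :=
      (totalDegree_mul _ _).trans (by rw [totalDegree_X])
    have hlow : (f * ∏ l ∈ T, (X (v l) - C (c l))).totalDegree ≤ f.totalDegree + #T := by
      refine (totalDegree_mul _ _).trans (Nat.add_le_add_left ?_ _)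
      refine (totalDegree_finsetProd _ _).trans ?_
      rw [card_eq_sum_ones]
      refine sum_le_sum fun j _ => (totalDegree_sub _ _).trans ?_
      simp
    rw [prod_insert hl, prod_insert hl, ← mul_assoc, ← mul_assoc, mul_sub, sub_mul, coeff_sub,
      ih _ (by omega), mul_comm f (C _), mul_assoc (C _), coeff_C_mul,
      coeff_eq_zero_of_totalDegree_lt (f := f * _), mul_zero, sub_zero]
    change _ < e.degree
    omega

variable (m k : ℕ)

/-- Regard a polynomial in `m + k` variables as a polynomial in the first `m` of them. -/
noncomputable def splitHom :
    MvPolynomial (Fin (m + k)) ℤ →ₐ[ℤ] MvPolynomial (Fin m) (MvPolynomial (Fin k) ℤ) :=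
  (sumAlgEquiv ℤ (Fin m) (Fin k)).toAlgHom.comp (rename finSumFinEquiv.symm)

variable {m k}

theorem splitHom_X_castAdd (i : Fin m) : splitHom m k (X (Fin.castAdd k i)) = X i := by
  simp [splitHom]

theorem splitHom_X_natAdd (j : Fin k) : splitHom m k (X (Fin.natAdd m j)) = C (X j) := by
  simp [splitHom]

theorem coeff_coeff_splitHom (p : MvPolynomial (Fin (m + k)) ℤ) (e : Fin (m + k) →₀ ℕ)
    (d₁ : Fin m →₀ ℕ) (d₂ : Fin k →₀ ℕ) (h₁ : ∀ i, d₁ i = e (Fin.castAdd k i))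
    (h₂ : ∀ j, d₂ j = e (Fin.natAdd m j)) :
    coeff d₂ (coeff d₁ (splitHom m k p)) = coeff e p := by
  rw [← coeff_rename_mapDomain finSumFinEquiv.symm finSumFinEquiv.symm.injective p e]
  have he : Finsupp.mapDomain finSumFinEquiv.symm e =
      Finsupp.sumFinsuppAddEquivProdFinsupp.symm (d₁, d₂) := by
    ext s
    rw [← Finsupp.equivMapDomain_eq_mapDomain, Finsupp.equivMapDomain_apply]
    rcases s with i | j <;> simp [h₁, h₂]
  rw [he]
  simp [splitHom, sumAlgEquiv, coeff, AddMonoidAlgebra.curryAlgEquiv,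
    AddMonoidAlgebra.curryRingEquiv, AddMonoidAlgebra.curryAddEquiv]

theorem splitHom_vandermondePoly : splitHom m k (vandermondePoly (m + k)) =
    MvPolynomial.map C (vandermondePoly m) * (∏ i : Fin m, ∏ j : Fin k, (X i - C (X j))) *
      C (vandermondePoly k) := by
  have hif {N : ℕ} : vandermondePoly N =
      ∏ i : Fin N, ∏ j : Fin N, if i < j then X i - X j else 1 := by
    rw [vandermondePoly_eq_prod_prod]
    refine prod_congr rfl fun i _ => ?_
    rw [← prod_filter]
    congr 1
    ext j
    simp
  have hmap {R S : Type} [CommRing R] [CommRing S] {N : ℕ} (φ : R →+* S) (x : Fin N → R) :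
      φ (∏ i, ∏ j, if i < j then x i - x j else 1) =
        ∏ i, ∏ j, if i < j then φ (x i) - φ (x j) else 1 := by
    simp only [map_prod, apply_ite φ, map_sub, map_one]
  have hle (i : Fin m) (j : Fin k) : (i : ℕ) < m + j := by omega
  have hge (i : Fin m) (j : Fin k) : ¬ m + (j : ℕ) < i := by omega
  have hsplit := hmap (splitHom m k).toRingHom (fun i => X i)
  simp only [AlgHom.toRingHom_eq_coe, RingHom.coe_coe] at hsplit
  rw [hif, hif, hif, hsplit, hmap, hmap]
  simp only [Fin.prod_univ_add, splitHom_X_castAdd, splitHom_X_natAdd, map_X, prod_mul_distrib]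
  simp [Fin.lt_def, -Fin.val_fin_lt, hle, hge, mul_assoc]

theorem coeff_vandermondePoly_add (e : Fin (m + k) →₀ ℕ) (d₁ : Fin m →₀ ℕ) (d₂ : Fin k →₀ ℕ)
    (h₁ : ∀ i, d₁ i + 3 * k = e (Fin.castAdd k i)) (h₂ : ∀ j, d₂ j = e (Fin.natAdd m j))
    (hd : 3 * m.choose 2 ≤ d₁.degree) :
    coeff e (vandermondePoly (m + k) ^ 3) =
      coeff d₁ (vandermondePoly m ^ 3) * coeff d₂ (vandermondePoly k ^ 3) := by
  let c : Fin m →₀ ℕ := Finsupp.equivFunOnFinite.symm fun _ => 3 * k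
  rw [← coeff_coeff_splitHom _ e (d₁ + c) d₂ (fun i => by simp [c, h₁]) h₂, map_pow,
    splitHom_vandermondePoly, mul_pow, mul_pow, ← map_pow, ← map_pow C, mul_comm, coeff_C_mul]
  have hprod (g : Fin m → Fin k → MvPolynomial (Fin m) (MvPolynomial (Fin k) ℤ)) :
      (∏ i, ∏ j, g i j) ^ 3 = ∏ l : Fin m × Fin k × Fin 3, g l.1 l.2.1 := by
    simp only [Fintype.prod_prod_type, prod_const, card_univ, Fintype.card_fin, prod_pow]
  rw [hprod, coeff_mul_prod_X_sub_C univ (fun l : Fin m × Fin k × Fin 3 => l.1)]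
  · have hX : ∏ l : Fin m × Fin k × Fin 3, (X l.1 : MvPolynomial (Fin m) (MvPolynomial (Fin k) ℤ)) =
        monomial c 1 := by
      rw [monomial_eq, Finsupp.prod_fintype _ _ (by simp)]
      simp [Fintype.prod_prod_type, c, mul_comm]
    rw [hX, coeff_mul_monomial, mul_one, coeff_map, mul_comm, coeff_C_mul]
  · have hdeg : (MvPolynomial.map (C : ℤ →+* MvPolynomial (Fin k) ℤ)
        (vandermondePoly m ^ 3)).totalDegree ≤
        3 * m.choose 2 :=
      (Finset.sup_mono (support_map_subset _ _)).trans <| (totalDegree_pow _ _).trans <|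
        Nat.mul_le_mul_left _ (totalDegree_vandermondePoly_le m)
    have hc : c.degree = m * (k * 3) := by
      simp [Finsupp.degree_eq_sum, c, mul_comm]
    rw [map_add, hc]
    simp only [card_univ, Fintype.card_prod, Fintype.card_fin]
    omega

end Split

theorem sum_fin_rectangle_exponent (m : ℕ) :
    ∑ i : Fin m, (2 * m - 2 - (i : ℕ)) = 3 * m.choose 2 := by
  have h : ∑ i : Fin m, (2 * m - 2 - (i : ℕ)) + ∑ i : Fin m, (i : ℕ) = m * (2 * (m - 1)) := by
    rw [← sum_add_distrib, sum_congr rfl fun i _ => (by omega : _ = 2 * (m - 1))]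
    simp
  rw [Fin.sum_univ_eq_sum_range (fun i => i) m, sum_range_id, ← Nat.choose_two_right] at h
  have := Nat.choose_two_right m
  have := Nat.div_two_mul_two_of_even (Nat.even_mul_pred_self m)
  rw [mul_left_comm] at h
  omega

/-- The exponent of the monomial extracting the Schur function of the rectangle with `m` rows of
length `m - 1`. -/
noncomputable def rectangleExponent (m : ℕ) : Fin m →₀ ℕ :=
  Finsupp.equivFunOnFinite.symm fun i => 2 * m - 2 - (i : ℕ)

theorem coeff_rectangleExponent (m : ℕ) :
    coeff (rectangleExponent m) (vandermondePoly m ^ 3) * (m.factorial * 2 ^ m) =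
      (-1) ^ m.choose 2 * ((2 * m).factorial : ℤ) :=
  coeff_vandermondePoly_pow_three m _ fun i => by
    simp only [rectangleExponent, Finsupp.equivFunOnFinite_symm_apply_apply]
    omega

theorem coeff_rectangleExponent_succ (m : ℕ) :
    coeff (rectangleExponent (m + 1)) (vandermondePoly (m + 1) ^ 3) =
      (-1 : ℤ) ^ m * (2 * m + 1) * coeff (rectangleExponent m) (vandermondePoly m ^ 3) := by
  have h := coeff_rectangleExponent m
  have h' := coeff_rectangleExponent (m + 1)
  have hchoose : (m + 1).choose 2 = m + m.choose 2 := by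
    rw [Nat.choose_succ_succ' m 1, Nat.choose_one_right]
  rw [show 2 * (m + 1) = 2 * m + 1 + 1 by ring, Nat.factorial_succ (2 * m + 1),
    Nat.factorial_succ (2 * m),
    Nat.factorial_succ m, hchoose] at h'
  push_cast at h'
  have hne : ((m + 1) * m.factorial * 2 ^ (m + 1) : ℤ) ≠ 0 := by positivity
  apply mul_right_cancel₀ hne
  rw [h']
  linear_combination (-(-1) ^ m * (2 * m + 1) * (m + 1) * 2 : ℤ) * h

theorem schurCoeff_one_of_top_rows {N m k : ℕ} (hN : N = m + k) (lam : Fin N → ℕ)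
    (htop : ∀ j : Fin N, (j : ℕ) < m → lam j = 2 * N - m - 1) :
    schurCoeff N 1 lam = coeff (rectangleExponent m) (vandermondePoly m ^ 3) *
      coeff (Finsupp.equivFunOnFinite.symm fun j : Fin k =>
        lam ⟨m + j, by omega⟩ + (k - 1 - (j : ℕ))) (vandermondePoly k ^ 3) := by
  subst hN
  refine coeff_vandermondePoly_add _ _ _ (fun i => ?_) (fun j => ?_) ?_
  · simp only [rectangleExponent, Finsupp.equivFunOnFinite_symm_apply_apply]
    rw [htop _ (by simp)]
    simp only [Fin.val_castAdd]
    omega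
  · simp only [Finsupp.equivFunOnFinite_symm_apply_apply]
    congr 1
    simp only [Fin.val_natAdd]
    omega
  · rw [Finsupp.degree_eq_sum, ← sum_fin_rectangle_exponent]
    simp [rectangleExponent]

/-- adding the tetris shape `T_0(n,m)` (a row of length `2n-m` on top of a
column of `m` boxes) multiplies the coefficient by `(-1)^m (2m+1)`. -/
theorem stmt_10 (n m : ℕ) (hm1 : 1 ≤ m) (hmn : m ≤ n)
    (lam : Fin n → ℕ) (hanti : Antitone lam)
    (hsum : ∑ j, lam j = n * (n - 1))
    (hlen : n - 1 ≤ (Finset.univ.filter fun j => lam j ≠ 0).card)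
    (htop : ∀ j : Fin n, (j : ℕ) < m → lam j = 2 * n - m - 1) :
    schurCoeff (n + 1) 1
        (fun j : Fin (n + 1) =>
          if (j : ℕ) < m + 1 then 2 * n - m
          else lam ⟨(j : ℕ) - 1, by have := j.2; omega⟩) =
      (-1 : ℤ) ^ m * (2 * m + 1) * schurCoeff n 1 lam := by
  obtain ⟨k, rfl⟩ := Nat.exists_eq_add_of_le hmn
  rw [schurCoeff_one_of_top_rows rfl lam htop,
    schurCoeff_one_of_top_rows (m := m + 1) (k := k) (by ring) _ fun j hj => ?_,
    coeff_rectangleExponent_succ, mul_assoc]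
  · congr 5
    ext j
    rw [if_neg (by simp; omega)]
    congr 3
    simp only
    omega
  · rw [if_pos hj]
    omega
end

section
/- Let n ≥ 2 and let λ = (2n−3, λ_2, …, λ_n) be a partition of n(n−1) with at most n parts and first part λ_1 = 2n−3. Let μ = (2n−1, 2n−2, λ_2, …, λ_n), a partition of n(n+1) with at most n+1 parts. Then ⟨a_{δ_{n+1}}^2, s_μ⟩ = −2 ⟨a_{δ_n}^2, s_λ⟩. -/
open MvPolynomial Finset

lemma vandermondePoly_eq (n : ℕ) :
    vandermondePoly n = ∏ i : Fin n, ∏ j : Fin n, if i < j then X i - X j else 1 := by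
  rw [vandermondePoly, Finset.prod_filter, ← Finset.univ_product_univ, Finset.prod_product]

lemma vandermondePoly_succ (n : ℕ) :
    vandermondePoly (n + 1) =
      (∏ j : Fin n, (X 0 - X j.succ)) * rename Fin.succ (vandermondePoly n) := by
  simp only [vandermondePoly_eq, Fin.prod_univ_succ, map_prod]
  simp [apply_ite (rename (R := ℤ) Fin.succ), Fin.succ_pos]

lemma finSuccEquiv_rename_succ {R : Type*} [CommSemiring R] {n : ℕ} (p : MvPolynomial (Fin n) R) :
    finSuccEquiv R n (rename Fin.succ p) = Polynomial.C p := by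
  induction p using MvPolynomial.induction_on with
  | C a => simp [finSuccEquiv_apply]
  | add p q hp hq => simp [hp, hq]
  | mul_X p i hp => simp [hp, finSuccEquiv_X_succ]

lemma finSuccEquiv_vandermondePoly (n : ℕ) :
    finSuccEquiv ℤ n (vandermondePoly (n + 1)) =
      (∏ j : Fin n, (Polynomial.X - Polynomial.C (X j))) * Polynomial.C (vandermondePoly n) := by
  simp [vandermondePoly_succ, finSuccEquiv_X_zero, finSuccEquiv_X_succ, finSuccEquiv_rename_succ]

lemma finSuccEquiv_sum_X (n : ℕ) :
    finSuccEquiv ℤ n (∑ j, X j) = Polynomial.X + Polynomial.C (∑ j, X j) := by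
  simp [Fin.sum_univ_succ, finSuccEquiv_X_zero, finSuccEquiv_X_succ]

section CubeCoeff

variable {R : Type*} [CommRing R] [Nontrivial R]

lemma natDegree_prod_X_sub_C_pow_three {n : ℕ} (x : Fin n → R) :
    ((∏ j, (Polynomial.X - Polynomial.C (x j))) ^ 3).natDegree = 3 * n := by
  rw [(Polynomial.monic_prod_X_sub_C x univ).natDegree_pow,
    Polynomial.natDegree_finsetProd_X_sub_C_eq_card]
  simp

lemma coeff_prod_X_sub_C_pow_three {n : ℕ} (x : Fin n → R) :
    ((∏ j, (Polynomial.X - Polynomial.C (x j))) ^ 3).coeff (3 * n) = 1 := by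
  have h := (Polynomial.monic_prod_X_sub_C x univ).pow 3
  rw [Polynomial.Monic, Polynomial.leadingCoeff, natDegree_prod_X_sub_C_pow_three] at h
  exact h

lemma coeff_prod_X_sub_C_pow_three_pred {n : ℕ} (x : Fin (n + 1) → R) :
    ((∏ j, (Polynomial.X - Polynomial.C (x j))) ^ 3).coeff (3 * n + 2) = -3 * ∑ j, x j := by
  have h := (Polynomial.monic_prod_X_sub_C x univ).nextCoeff_pow 3
  rw [Polynomial.prod_X_sub_C_nextCoeff, Polynomial.nextCoeff_of_natDegree_pos
    (by rw [natDegree_prod_X_sub_C_pow_three]; omega), natDegree_prod_X_sub_C_pow_three,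
    show 3 * (n + 1) - 1 = 3 * n + 2 by omega] at h
  rw [h]
  simp

end CubeCoeff

lemma coeff_cons_vandermondePoly_pow_three (n : ℕ) (m : Fin (n + 1) →₀ ℕ) :
    coeff (m.cons (3 * n + 2)) (vandermondePoly (n + 2) ^ 3) =
      -3 * coeff m ((∑ j, X j) * vandermondePoly (n + 1) ^ 3) := by
  rw [← finSuccEquiv_coeff_coeff, map_pow, finSuccEquiv_vandermondePoly, mul_pow, ← map_pow,
    Polynomial.coeff_mul_C, coeff_prod_X_sub_C_pow_three_pred, mul_assoc,
    show (-3 : MvPolynomial (Fin (n + 1)) ℤ) = C (-3) by simp, coeff_C_mul]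

lemma coeff_cons_sum_X_mul_vandermondePoly_pow_three (n : ℕ) (m : Fin (n + 1) →₀ ℕ) :
    coeff (m.cons (3 * n + 3)) ((∑ j, X j) * vandermondePoly (n + 2) ^ 3) =
      -2 * coeff m ((∑ j, X j) * vandermondePoly (n + 1) ^ 3) := by
  have htop := coeff_prod_X_sub_C_pow_three (X : Fin (n + 1) → MvPolynomial (Fin (n + 1)) ℤ)
  rw [mul_add_one] at htop
  rw [← finSuccEquiv_coeff_coeff, map_mul, map_pow, finSuccEquiv_vandermondePoly,
    finSuccEquiv_sum_X, mul_pow, ← map_pow, ← mul_assoc, Polynomial.coeff_mul_C, add_mul,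
    Polynomial.coeff_add, Polynomial.coeff_X_mul, Polynomial.coeff_C_mul, htop,
    coeff_prod_X_sub_C_pow_three_pred, ← coeff_C_mul]
  congr 1
  simp only [map_neg, map_ofNat]
  ring

/-- adding the tetris shape `T_1(n,1)` (parts `2n-1, 2n-2` on top)
multiplies the coefficient by `-2` when `λ_1 = 2n-3`. -/
theorem stmt_12 (n : ℕ) (hn : 2 ≤ n)
    (lam : Fin n → ℕ) (hanti : Antitone lam)
    (hsum : ∑ j, lam j = n * (n - 1))
    (hfirst : lam ⟨0, by omega⟩ = 2 * n - 3) :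
    schurCoeff (n + 1) 1
        (fun j : Fin (n + 1) =>
          if (j : ℕ) = 0 then 2 * n - 1
          else if (j : ℕ) = 1 then 2 * n - 2
          else lam ⟨(j : ℕ) - 1, by have := j.2; omega⟩) =
      -2 * schurCoeff n 1 lam := by
  obtain ⟨k, rfl⟩ := Nat.exists_eq_add_of_le' hn
  set m : Fin (k + 1) →₀ ℕ :=
    Finsupp.equivFunOnFinite.symm fun i => lam i.succ + (k - (i : ℕ)) with hm
  have hlam : (Finsupp.equivFunOnFinite.symm fun i : Fin (k + 2) => lam i + (k + 2 - 1 - (i : ℕ))) =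
      m.cons (3 * k + 2) := by
    ext i
    refine Fin.cases ?_ (fun i => ?_) i
    · have : lam 0 = 2 * (k + 2) - 3 := hfirst
      simp only [Finsupp.equivFunOnFinite_symm_apply_apply, Finsupp.cons_zero, Fin.val_zero]
      omega
    · simp only [hm, Finsupp.equivFunOnFinite_symm_apply_apply, Finsupp.cons_succ, Fin.val_succ]
      omega
  simp only [schurCoeff, Nat.reduceMul, Nat.reduceAdd]
  rw [hlam, coeff_cons_vandermondePoly_pow_three]
  have hmu : ∀ f : Fin (k + 3) → ℕ, f 0 = 3 * (k + 1) + 2 → f 1 = 3 * k + 3 →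
      (∀ i : Fin (k + 1), f i.succ.succ = m i) →
      Finsupp.equivFunOnFinite.symm f = (m.cons (3 * k + 3)).cons (3 * (k + 1) + 2) := by
    intro f h0 h1 h2
    ext i
    refine Fin.cases (by simpa using h0) (fun i => Fin.cases ?_ (fun i => ?_) i) i
    · exact h1
    · simpa using h2 i
  rw [hmu, coeff_cons_vandermondePoly_pow_three, coeff_cons_sum_X_mul_vandermondePoly_pow_three]
  · ring
  · simp
    omega
  · simp
    omega
  · intro i
    simp [hm, Fin.succ]
end
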